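/- arXiv:2209.14140 — 6 statements merged into one kernel-verified Lean document; each statement's English description precedes it below -/
import Mathlib

section
/- Let S be a nonempty finite set and let q : S → ℝ satisfy 0 < q_w ≤ 1/2 for every w ∈ S, and set σ = ∑_{w∈S} q_w. Then ∑_{v∈S} q_v · ∏_{w∈S, w≠v} (1 − q_w) > σ · (1/4)^{σ}. -/
/-- If every transmission probability lies in `(0, 1/2]` and `σ` is their sum,
then the per-round success probability `∑_v q v * ∏_{w ≠ v} (1 - q w)`
exceeds `σ * (1/4) ^ σ` (real exponentiation). -/
theorem stmt2 {α : Type*} [DecidableEq α] (S : Finset α) (hS : S.Nonempty)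
    (q : α → ℝ) (hq : ∀ w ∈ S, 0 < q w ∧ q w ≤ 1 / 2) :
    ∑ v ∈ S, q v * ∏ w ∈ S.erase v, (1 - q w) >
      (∑ w ∈ S, q w) * (1 / 4 : ℝ) ^ (∑ w ∈ S, q w) := by
  have key : ∀ w ∈ S, (1 / 4 : ℝ) ^ (q w) ≤ 1 - q w := by
    intro w hw
    obtain ⟨h0, h1⟩ := hq w hw
    have h := rpow_one_add_le_one_add_mul_self (s := (-1 / 2 : ℝ)) (by norm_num)
      (p := 2 * q w) (by linarith) (by linarith)
    rw [Real.rpow_mul (by norm_num)] at h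
    have e : ((1 + -1 / 2 : ℝ) ^ (2 : ℝ)) = 1 / 4 := by
      rw [Real.rpow_two]; norm_num
    rw [e] at h
    linarith
  have hprod : (1 / 4 : ℝ) ^ (∑ w ∈ S, q w) ≤ ∏ w ∈ S, (1 - q w) := by
    rw [Real.rpow_sum_of_pos (by norm_num)]
    exact Finset.prod_le_prod (fun w _ => by positivity) key
  rw [gt_iff_lt, Finset.sum_mul]
  apply Finset.sum_lt_sum_of_nonempty hS
  intro v hv
  have hv' := (hq v hv).1
  apply mul_lt_mul_of_pos_left _ hv'
  refine lt_of_le_of_lt hprod ?_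
  rw [← Finset.mul_prod_erase S _ hv]
  have hpos : 0 < ∏ w ∈ S.erase v, (1 - q w) := by
    apply Finset.prod_pos
    intro w hw
    have := (hq w (Finset.mem_of_mem_erase hw)).2
    linarith
  nlinarith
end

section
/- Let S be a finite set and let p : S → ℝ satisfy 0 ≤ p_v ≤ 1 for every v ∈ S, and set σ = ∑_{v∈S} p_v. Then ∑_{v∈S} p_v · ∏_{w∈S, w≠v} (1 − p_w) ≤ σ · e^{1−σ}. -/
/-- Core estimate of Lemma 4.1: if every transmission probability lies in
`[0, 1]` and `σ` is their sum, then the per-round success probability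
`∑_v p v * ∏_{w ≠ v} (1 - p w)` is at most `σ * e^{1 - σ}`. -/
theorem stmt3 {α : Type*} [DecidableEq α] (S : Finset α) (p : α → ℝ)
    (hp : ∀ v ∈ S, 0 ≤ p v ∧ p v ≤ 1) :
    ∑ v ∈ S, p v * ∏ w ∈ S.erase v, (1 - p w) ≤
      (∑ v ∈ S, p v) * Real.exp (1 - ∑ v ∈ S, p v) := by
  rw [Finset.sum_mul]
  refine Finset.sum_le_sum fun v hv => mul_le_mul_of_nonneg_left ?_ (hp v hv).1
  have h1 : ∏ w ∈ S.erase v, (1 - p w) ≤ ∏ w ∈ S.erase v, Real.exp (-p w) := by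
    refine Finset.prod_le_prod (fun w hw => ?_) (fun w _ => ?_)
    · have := (hp w (Finset.mem_of_mem_erase hw)).2
      linarith
    · have := Real.add_one_le_exp (-p w)
      linarith
  refine h1.trans ?_
  rw [← Real.exp_sum, Finset.sum_neg_distrib]
  apply Real.exp_le_exp.mpr
  have h2 := Finset.add_sum_erase S p hv
  have h3 := (hp v hv).2
  linarith
end

section
/- Let b be a positive integer and define p(i) = (ln j)/j for integers i ≥ 1, where j = 3 + ⌊(i−1)/b⌋. There exists k₀ such that for every integer k ≥ k₀ the following holds: for every set V of k stations and every assignment of integer wake-up times (t_v)_{v∈V}, setting r = 4·k·ln²k and T = ⌊b·r⌋, the number of integers t ∈ {1, …, T} for which ∑_{v∈V : t_v < t} p(t − t_v) < 1 is at least T/2. -/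
open scoped Classical

/-- Transmission probability of protocol `SublinearDecrease(b)` in local round
`i ≥ 1`: it equals `(ln j)/j` where `j = 3 + ⌊(i-1)/b⌋`. -/
noncomputable def subProb (b i : ℕ) : ℝ :=
  Real.log ((3 + (i - 1) / b : ℕ) : ℝ) / ((3 + (i - 1) / b : ℕ) : ℝ)

lemma subProb_nonneg (b i : ℕ) : 0 ≤ subProb b i := by
  unfold subProb
  exact div_nonneg (Real.log_natCast_nonneg _) (Nat.cast_nonneg _)

lemma subProb_anti (b : ℕ) {i j : ℕ} (h : i ≤ j) : subProb b j ≤ subProb b i := by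
  unfold subProb
  have he : Real.exp 1 ≤ 3 := by linarith [Real.exp_one_lt_d9]
  have hle : 3 + (i - 1) / b ≤ 3 + (j - 1) / b := by
    have := Nat.div_le_div_right (c := b) (Nat.sub_le_sub_right h 1)
    omega
  apply Real.log_div_self_antitoneOn
  · change Real.exp 1 ≤ _
    push_cast
    have : (0:ℝ) ≤ (((i - 1) / b : ℕ) : ℝ) := Nat.cast_nonneg _
    push_cast at this
    linarith
  · change Real.exp 1 ≤ _
    push_cast
    have : (0:ℝ) ≤ (((j - 1) / b : ℕ) : ℝ) := Nat.cast_nonneg _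
    push_cast at this
    linarith
  · exact_mod_cast hle

lemma station_le (b T : ℕ) (s : ℤ) :
    ∑ t ∈ (Finset.Icc 1 T).filter (fun t : ℕ => s < (t : ℤ)), subProb b ((t : ℤ) - s).toNat
      ≤ ∑ i ∈ Finset.Icc 1 T, subProb b i := by
  by_cases hs : 0 ≤ s
  · have hinj : Set.InjOn (fun t : ℕ => ((t : ℤ) - s).toNat)
        ((Finset.Icc 1 T).filter (fun t : ℕ => s < (t : ℤ)) : Finset ℕ) := by
      intro x hx y hy hxy
      simp only [Finset.coe_filter, Finset.mem_Icc, Set.mem_ofPred_eq] at hx hy hxy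
      omega
    rw [← Finset.sum_image (f := subProb b) hinj]
    apply Finset.sum_le_sum_of_subset_of_nonneg
    · intro x hx
      simp only [Finset.mem_image, Finset.mem_filter, Finset.mem_Icc] at hx ⊢
      obtain ⟨t, ht, rfl⟩ := hx
      omega
    · intro i _ _
      exact subProb_nonneg b i
  · refine le_trans (Finset.sum_le_sum (g := fun t => subProb b t) ?_) ?_
    · intro t ht
      apply subProb_anti
      omega
    · apply Finset.sum_le_sum_of_subset_of_nonneg (Finset.filter_subset _ _)
      intro i _ _
      exact subProb_nonneg b i

lemma subProb_le (b : ℕ) (hb : 1 ≤ b) (T i : ℕ) (hi : 1 ≤ i) (hiT : i ≤ T) :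
    subProb b i ≤ (b * Real.log (3 + T)) * (i : ℝ)⁻¹ := by
  unfold subProb
  set q := (i - 1) / b with hq
  have h1 : q ≤ T := le_trans (Nat.div_le_self _ _) (by omega)
  have h2 : i ≤ b * (3 + q) := by
    have := Nat.lt_mul_div_succ (i - 1) (show 0 < b by omega)
    rw [← hq] at this
    nlinarith [Nat.sub_add_cancel hi]
  have hipos : (0:ℝ) < i := by exact_mod_cast hi
  have h3 : Real.log ((3 + q : ℕ) : ℝ) ≤ Real.log (3 + T) := by
    apply Real.log_le_log
    · positivity
    · exact_mod_cast (by omega : 3 + q ≤ 3 + T)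
  have h0 : 0 ≤ Real.log ((3 + q : ℕ) : ℝ) := Real.log_natCast_nonneg _
  have h2' : (i : ℝ) ≤ b * ((3 + q : ℕ) : ℝ) := by exact_mod_cast h2
  have hjpos : (0:ℝ) < ((3 + q : ℕ) : ℝ) := by positivity
  rw [← div_eq_mul_inv, div_le_div_iff₀ hjpos hipos]
  calc Real.log ((3 + q : ℕ) : ℝ) * i
      ≤ Real.log (3 + T) * (b * ((3 + q : ℕ) : ℝ)) :=
        mul_le_mul h3 h2' hipos.le (h0.trans h3)
    _ = _ := by ring

lemma sum_subProb_le (b : ℕ) (hb : 1 ≤ b) (T : ℕ) :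
    ∑ i ∈ Finset.Icc 1 T, subProb b i ≤ b * (1 + Real.log (3 + T)) ^ 2 := by
  have hL : 0 ≤ Real.log (3 + T) := Real.log_nonneg (by
    have : (0:ℝ) ≤ T := Nat.cast_nonneg _
    linarith)
  have hb0 : (0:ℝ) ≤ b := Nat.cast_nonneg _
  have hH : ∑ i ∈ Finset.Icc 1 T, (i : ℝ)⁻¹ ≤ 1 + Real.log (3 + T) := by
    have h := harmonic_le_one_add_log T
    rw [harmonic_eq_sum_Icc] at h
    push_cast at h
    refine h.trans ?_
    rcases Nat.eq_zero_or_pos T with h0 | h0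
    · subst h0
      simp only [Nat.cast_zero, Real.log_zero] at hL ⊢
      linarith
    · have := Real.log_le_log (x := (T:ℝ)) (y := 3 + T) (by exact_mod_cast h0) (by linarith)
      linarith
  calc ∑ i ∈ Finset.Icc 1 T, subProb b i
      ≤ ∑ i ∈ Finset.Icc 1 T, (b * Real.log (3 + T)) * (i : ℝ)⁻¹ := by
        apply Finset.sum_le_sum
        intro i hi
        rw [Finset.mem_Icc] at hi
        exact subProb_le b hb T i hi.1 hi.2
    _ = (b * Real.log (3 + T)) * ∑ i ∈ Finset.Icc 1 T, (i : ℝ)⁻¹ := by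
        rw [Finset.mul_sum]
    _ ≤ (b * Real.log (3 + T)) * (1 + Real.log (3 + T)) := by gcongr
    _ ≤ _ := by nlinarith [mul_nonneg hb0 hL]

lemma count_bound (b T : ℕ) (hb : 1 ≤ b) (α : Type) (V : Finset α) (tv : α → ℤ)
    (h : (V.card : ℝ) * (b * (1 + Real.log (3 + T)) ^ 2) ≤ T / 2) :
    (T : ℝ) / 2 ≤ (((Finset.Icc 1 T).filter (fun t : ℕ =>
              (∑ v ∈ V.filter (fun v => tv v < (t : ℤ)),
                subProb b ((t : ℤ) - tv v).toNat) < 1)).card : ℝ) := by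
  set σ : ℕ → ℝ := fun t => ∑ v ∈ V.filter (fun v => tv v < (t : ℤ)),
                subProb b ((t : ℤ) - tv v).toNat with hσ
  have hσ0 : ∀ t, 0 ≤ σ t := fun t => Finset.sum_nonneg (fun v _ => subProb_nonneg _ _)
  have hsum : ∑ t ∈ Finset.Icc 1 T, σ t ≤ T / 2 := by
    refine le_trans ?_ h
    have : ∑ t ∈ Finset.Icc 1 T, σ t = ∑ v ∈ V,
        ∑ t ∈ (Finset.Icc 1 T).filter (fun t : ℕ => tv v < (t : ℤ)),
          subProb b ((t : ℤ) - tv v).toNat := by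
      simp only [hσ, Finset.sum_filter]
      exact Finset.sum_comm
    rw [this, ← nsmul_eq_mul]
    apply Finset.sum_le_card_nsmul
    intro v _
    exact (station_le b T (tv v)).trans (sum_subProb_le b hb T)
  have hbad : (((Finset.Icc 1 T).filter (fun t => ¬ σ t < 1)).card : ℝ) ≤ T / 2 := by
    refine le_trans ?_ hsum
    refine le_trans ?_ (Finset.sum_le_sum_of_subset_of_nonneg
      (Finset.filter_subset (fun t => ¬ σ t < 1) _) (fun i _ _ => hσ0 i))
    rw [Finset.card_eq_sum_ones]
    push_cast
    apply Finset.sum_le_sum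
    intro t ht
    exact not_lt.mp (Finset.mem_filter.mp ht).2
  have hc := Finset.card_filter_add_card_filter_not (s := Finset.Icc 1 T) (fun t => σ t < 1)
  rw [Nat.card_Icc, Nat.add_sub_cancel] at hc
  have hc' : (((Finset.Icc 1 T).filter (fun t => σ t < 1)).card : ℝ)
    + (((Finset.Icc 1 T).filter (fun t => ¬ σ t < 1)).card : ℝ) = T := by exact_mod_cast hc
  linarith

lemma eventually_log_bound (b : ℕ) :
    ∀ᶠ k : ℕ in Filter.atTop, 1 ≤ k ∧ 4 ≤ Real.log k ∧
      1 + Real.log (7 * b) + 2 * Real.log (Real.log k) ≤ Real.log k / 4 := by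
  have hlog : Filter.Tendsto (fun k : ℕ => Real.log k) Filter.atTop Filter.atTop :=
    Real.tendsto_log_atTop.comp tendsto_natCast_atTop_atTop
  have h1 := Real.isLittleO_log_id_atTop.bound (show (0:ℝ) < 1 / 16 by norm_num)
  have h2 := hlog.eventually h1
  filter_upwards [h2, hlog.eventually_ge_atTop 4,
    hlog.eventually_ge_atTop (8 * (1 + Real.log (7 * b))), Filter.eventually_ge_atTop 1]
    with k ha hb hc hd
  refine ⟨hd, hb, ?_⟩
  simp only [id, Real.norm_eq_abs] at ha
  rw [abs_of_nonneg (show 0 ≤ Real.log k by linarith)] at ha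
  have := le_abs_self (Real.log (Real.log k))
  linarith

/-- Lemma 5.3 (deterministic form): for every positive integer `b` there is `k₀`
such that for every `k ≥ k₀`, every set `V` of `k` stations and every assignment
of integer wake-up times `tv`, setting `r = 4·k·ln²k` and `T = ⌊b·r⌋`, in at
least `T/2` of the rounds `t ∈ {1, …, T}` the sum
`σ̂[t] = ∑_{v : tv v < t} p(t - tv v)` of the transmission probabilities of all
stations activated before round `t` is smaller than `1`. -/
theorem stmt7 (b : ℕ) (hb : 1 ≤ b) :
    ∃ k₀ : ℕ, ∀ k : ℕ, k₀ ≤ k →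
      ∀ (α : Type) (V : Finset α) (tv : α → ℤ), V.card = k →
        ((⌊(b : ℝ) * (4 * (k : ℝ) * (Real.log k) ^ 2)⌋₊ : ℝ) / 2 ≤
          (((Finset.Icc 1 ⌊(b : ℝ) * (4 * (k : ℝ) * (Real.log k) ^ 2)⌋₊).filter
            (fun t : ℕ =>
              (∑ v ∈ V.filter (fun v => tv v < (t : ℤ)),
                subProb b ((t : ℤ) - tv v).toNat) < 1)).card : ℝ)) := by
  obtain ⟨k₀, hk₀⟩ := Filter.eventually_atTop.mp (eventually_log_bound b)
  refine ⟨k₀, fun k hk α V tv hV => ?_⟩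
  obtain ⟨hk1, hy, hlog⟩ := hk₀ k hk
  apply count_bound b _ hb α V tv
  rw [hV]
  have hb1 : (1:ℝ) ≤ b := by exact_mod_cast hb
  have hkr : (1:ℝ) ≤ k := by exact_mod_cast hk1
  set y := Real.log k with hydef
  set X : ℝ := (b : ℝ) * (4 * (k : ℝ) * y ^ 2) with hX
  have hbk : (1:ℝ) ≤ b * k := by nlinarith
  have hbky : (16:ℝ) ≤ b * k * y ^ 2 := by
    have : (16:ℝ) ≤ y ^ 2 := by nlinarith
    nlinarith
  have hX0 : 0 ≤ X := by positivity
  have hT1 : (⌊X⌋₊ : ℝ) ≤ X := Nat.floor_le hX0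
  have hT2 : X < ⌊X⌋₊ + 1 := Nat.lt_floor_add_one X
  have hl : Real.log (3 + ⌊X⌋₊) ≤ Real.log (7 * b) + y + 2 * Real.log y := by
    have : Real.log (7 * b) + y + 2 * Real.log y = Real.log (7 * b * k * y ^ 2) := by
      rw [Real.log_mul (x := 7 * b * k) (by positivity) (by positivity),
        Real.log_mul (x := 7 * b) (y := k) (by positivity) (by positivity), Real.log_pow]
      push_cast
      ring
    rw [this]
    apply Real.log_le_log (by positivity)
    linarith
  have hl0 : 0 ≤ Real.log (3 + ⌊X⌋₊) := Real.log_nonneg (by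
    have : (0:ℝ) ≤ ⌊X⌋₊ := Nat.cast_nonneg _
    linarith)
  have hsq : (1 + Real.log (3 + ⌊X⌋₊)) ^ 2 ≤ (5 / 4 * y) ^ 2 := by
    apply pow_le_pow_left₀ (by linarith)
    linarith
  calc (k:ℝ) * (b * (1 + Real.log (3 + ⌊X⌋₊)) ^ 2)
      ≤ k * (b * (5 / 4 * y) ^ 2) := by gcongr
    _ ≤ (⌊X⌋₊ : ℝ) / 2 := by nlinarith
end

section
/- For every constant b > 0 there exist a constant b₁ > 0 and k₀ such that for every integer k ≥ k₀ the following holds. Set r = 2·k·ln²k/(b₁·ln ln k). For every nonempty finite set S and every q : S → ℝ with 0 < q_v ≤ 1/2 for all v ∈ S and 1 < ∑_{v∈S} q_v ≤ b₁·ln ln k, one has ∑_{v∈S} q_v · ∏_{w∈S, w≠v} (1 − q_w) ≥ 16k/(b·r). -/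
/-- Lemma 5.4: for every constant `b > 0` there are a constant `b₁ > 0` and `k₀`
such that for every `k ≥ k₀` and every round whose transmission probabilities
`q v ∈ (0, 1/2]` sum to a value in `(1, b₁·ln ln k]`, the success probability
`∑_v q v · ∏_{w ≠ v} (1 - q w)` is at least `16k/(b·r)`, where
`r = 2·k·ln²k/(b₁·ln ln k)`. -/
theorem stmt8 (b : ℝ) (hb : 0 < b) :
    ∃ b₁ : ℝ, 0 < b₁ ∧ ∃ k₀ : ℕ, ∀ k : ℕ, k₀ ≤ k →
      ∀ (α : Type) [DecidableEq α] (S : Finset α) (q : α → ℝ), S.Nonempty →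
        (∀ v ∈ S, 0 < q v ∧ q v ≤ 1 / 2) →
        1 < ∑ v ∈ S, q v →
        ∑ v ∈ S, q v ≤ b₁ * Real.log (Real.log k) →
        16 * (k : ℝ) /
            (b * (2 * (k : ℝ) * (Real.log k) ^ 2 / (b₁ * Real.log (Real.log k)))) ≤
          ∑ v ∈ S, q v * ∏ w ∈ S.erase v, (1 - q w) := by
  refine ⟨1 / 2, by norm_num, ?_⟩
  have ht : Filter.Tendsto (fun k : ℕ => Real.log (Real.log (k : ℝ))) Filter.atTop Filter.atTop :=
    Real.tendsto_log_atTop.comp (Real.tendsto_log_atTop.comp tendsto_natCast_atTop_atTop)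
  have hl : Filter.Tendsto (fun k : ℕ => Real.log (k : ℝ)) Filter.atTop Filter.atTop :=
    Real.tendsto_log_atTop.comp tendsto_natCast_atTop_atTop
  obtain ⟨k₀, hk₀⟩ := Filter.eventually_atTop.mp
    (((ht.eventually_ge_atTop (8 / b)).and (hl.eventually_ge_atTop 1)).and
      (Filter.eventually_ge_atTop 1))
  refine ⟨k₀, fun k hk α _ S q _ hq h1 h2 => ?_⟩
  obtain ⟨⟨hL, hlog⟩, hk1⟩ := hk₀ k hk
  have hkpos : (0 : ℝ) < k := by exact_mod_cast hk1
  have hexp : Real.exp (Real.log (Real.log k)) = Real.log k := Real.exp_log (by linarith)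
  generalize Real.log (Real.log (k : ℝ)) = L at *
  rw [← hexp]
  have hLpos : 0 < L := lt_of_lt_of_le (by positivity) hL
  have h8 : 8 ≤ L * b := (div_le_iff₀ hb).mp hL
  have hle : ∀ v ∈ S, Real.exp (-(2 * q v)) ≤ 1 - q v := by
    intro v hv
    obtain ⟨h0, hh⟩ := hq v hv
    have hp : 0 < 1 - q v := by linarith
    have h3 : 1 + 2 * q v ≤ Real.exp (2 * q v) := by linarith [Real.add_one_le_exp (2 * q v)]
    rw [Real.exp_neg, inv_le_comm₀ (Real.exp_pos _) hp]
    refine le_trans ?_ h3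
    rw [inv_le_iff_one_le_mul₀ hp]
    nlinarith
  have hprod : ∀ v ∈ S, Real.exp (-L) ≤ ∏ w ∈ S.erase v, (1 - q w) := by
    intro v hv
    calc Real.exp (-L) ≤ Real.exp (∑ w ∈ S.erase v, -(2 * q w)) := by
          apply Real.exp_le_exp.mpr
          rw [Finset.sum_neg_distrib, ← Finset.mul_sum]
          have := Finset.add_sum_erase S q hv
          have := (hq v hv).1
          linarith
      _ = ∏ w ∈ S.erase v, Real.exp (-(2 * q w)) := Real.exp_sum _ _
      _ ≤ _ := Finset.prod_le_prod (fun _ _ => (Real.exp_pos _).le)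
          (fun w hw => hle w (Finset.mem_of_mem_erase hw))
  have hsum : Real.exp (-L) ≤ ∑ v ∈ S, q v * ∏ w ∈ S.erase v, (1 - q w) := by
    calc Real.exp (-L) ≤ (∑ v ∈ S, q v) * Real.exp (-L) :=
          le_mul_of_one_le_left (Real.exp_pos _).le h1.le
      _ = ∑ v ∈ S, q v * Real.exp (-L) := Finset.sum_mul _ _ _
      _ ≤ _ := Finset.sum_le_sum fun v hv =>
          mul_le_mul_of_nonneg_left (hprod v hv) (hq v hv).1.le
  refine le_trans ?_ hsum
  have hq2 := Real.quadratic_le_exp_of_nonneg hLpos.le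
  rw [Real.exp_neg]
  have hE := Real.exp_pos L
  generalize Real.exp L = E at *
  have hEq : 16 * (k : ℝ) / (b * (2 * (k : ℝ) * E ^ 2 / (1 / 2 * L))) = (4 * L / (b * E)) * E⁻¹ := by
    field_simp
    norm_num
  rw [hEq]
  apply mul_le_of_le_one_left (by positivity)
  rw [div_le_one (by positivity)]
  have : b * (L ^ 2 / 2) ≤ b * E := mul_le_mul_of_nonneg_left (by linarith) hb.le
  nlinarith
end

section
/- There exists k₀ such that for every integer k ≥ k₀ the following holds. Let L = ⌊log₂ log₂ k⌋ and let a₀, …, a_L and b₀, …, b_L be nonnegative reals with ∑_{l=0}^{L} b_l ≤ k and a_l ≤ max(b_l/2^l, √k) for every l ∈ {0, …, L}. Then ∑_{l=0}^{L} a_l · 2^l/(2k) < 1. -/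
theorem four_sq_le_two_pow (m : ℕ) (hm : 8 ≤ m) : 4 * m ^ 2 ≤ 2 ^ m := by
  induction m, hm using Nat.le_induction with
  | base => norm_num
  | succ n hn ih =>
    rw [pow_succ 2 n]
    nlinarith

/-- Deterministic core of Lemma 3.3: for all sufficiently large `k`, with
`L = ⌊log₂ log₂ k⌋`, if `b l ≥ 0` sum to at most `k` and
`a l ≤ max(b l / 2^l, √k)` with `a l ≥ 0` for every `l ≤ L`, then
`∑_{l=0}^{L} a l · 2^l/(2k) < 1`. -/
theorem stmt9 :
    ∃ k₀ : ℕ, ∀ k : ℕ, k₀ ≤ k →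
      ∀ a b : ℕ → ℝ,
        (∀ l ≤ Nat.log 2 (Nat.log 2 k), 0 ≤ a l) →
        (∀ l ≤ Nat.log 2 (Nat.log 2 k), 0 ≤ b l) →
        (∑ l ∈ Finset.range (Nat.log 2 (Nat.log 2 k) + 1), b l) ≤ (k : ℝ) →
        (∀ l ≤ Nat.log 2 (Nat.log 2 k),
          a l ≤ max (b l / 2 ^ l) (Real.sqrt k)) →
        ∑ l ∈ Finset.range (Nat.log 2 (Nat.log 2 k) + 1),
            a l * 2 ^ l / (2 * (k : ℝ)) < 1 := by
  refine ⟨256, ?_⟩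
  intro k hk a b _ hb hsum hab
  set m := Nat.log 2 k with hm
  set L := Nat.log 2 m with hL
  have hm8 : 8 ≤ m := Nat.le_log_of_pow_le (by norm_num) (by norm_num; exact hk)
  have h1 : 2 ^ L ≤ m := Nat.pow_log_le_self 2 (by omega)
  have h2 : 2 ^ m ≤ k := Nat.pow_log_le_self 2 (by omega)
  have h3 : (2 * m) ^ 2 ≤ k := by
    have := four_sq_le_two_pow m hm8
    nlinarith
  have hkpos : (0 : ℝ) < k := by
    have : 0 < k := by omega
    exact_mod_cast this
  have hs : 0 < Real.sqrt k := Real.sqrt_pos.mpr hkpos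
  have hss : Real.sqrt k * Real.sqrt k = k := Real.mul_self_sqrt hkpos.le
  have h4 : (2 * m : ℝ) ≤ Real.sqrt k := Real.le_sqrt_of_sq_le (by exact_mod_cast h3)
  have h1' : (2 : ℝ) ^ L ≤ m := by exact_mod_cast h1
  have hterm : ∀ l ∈ Finset.range (L + 1), a l * 2 ^ l ≤ b l + Real.sqrt k * 2 ^ l := by
    intro l hl
    have hl' : l ≤ L := by
      have := Finset.mem_range.mp hl
      omega
    have hp : (0 : ℝ) < 2 ^ l := by positivity
    have hbl := hb l hl'
    have h := hab l hl'
    rcases le_max_iff.mp h with h | h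
    · rw [le_div_iff₀ hp] at h
      have := mul_pos hs hp
      linarith
    · have := mul_le_mul_of_nonneg_right h hp.le
      linarith
  have hS := Finset.sum_le_sum hterm
  rw [Finset.sum_add_distrib, ← Finset.mul_sum, geom_sum_eq (by norm_num), pow_succ] at hS
  rw [← Finset.sum_div, div_lt_one (by linarith)]
  have h5 : Real.sqrt k * ((2 ^ L * 2 - 1) / (2 - 1)) < Real.sqrt k * Real.sqrt k := by
    apply mul_lt_mul_of_pos_left _ hs
    norm_num
    linarith
  linarith
end

section
/- For all positive integers q and δ, ∏_{i=1}^{δ} (1 − q/(2(2q+i))) ≤ (2e·q/(1+δ))^{q/2}. -/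
lemma aux_sum (q δ : ℕ) :
    Real.log (2 * (q : ℝ) + 1 + δ) - Real.log (2 * (q : ℝ) + 1) ≤
      ∑ i ∈ Finset.Icc 1 δ, 1 / (2 * (q : ℝ) + (i : ℝ)) := by
  induction δ with
  | zero => simp
  | succ n ih =>
    rw [Finset.sum_Icc_succ_top (by omega)]
    have hp : (0 : ℝ) < 2 * (q : ℝ) + 1 + n := by positivity
    have h2 : (0 : ℝ) < 2 * (q : ℝ) + 1 + n + 1 := by positivity
    have h := Real.log_le_sub_one_of_pos (div_pos h2 hp)
    rw [Real.log_div h2.ne' hp.ne'] at h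
    have e : (2 * (q : ℝ) + 1 + n + 1) / (2 * (q : ℝ) + 1 + n) - 1
        = 1 / (2 * (q : ℝ) + ((n + 1 : ℕ) : ℝ)) := by
      push_cast
      have : (2 * (q : ℝ) + (n + 1)) ≠ 0 := by positivity
      field_simp
      ring
    rw [e] at h
    have e2 : 2 * (q : ℝ) + 1 + ((n + 1 : ℕ) : ℝ) = 2 * (q : ℝ) + 1 + n + 1 := by
      push_cast; ring
    rw [e2]
    linarith

/-- Key product estimate for the light rounds in the analysis of
`DecreaseSlowly` (Theorem 6.2): for all positive integers `q` and `δ`,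
`∏_{i=1}^{δ} (1 − q/(2(2q+i))) ≤ (2e·q/(1+δ))^{q/2}` (real exponentiation). -/
theorem stmt10 (q δ : ℕ) (hq : 1 ≤ q) (hδ : 1 ≤ δ) :
    ∏ i ∈ Finset.Icc 1 δ, (1 - (q : ℝ) / (2 * (2 * (q : ℝ) + (i : ℝ)))) ≤
      (2 * Real.exp 1 * (q : ℝ) / (1 + (δ : ℝ))) ^ ((q : ℝ) / 2) := by
  have hq' : (1 : ℝ) ≤ q := by exact_mod_cast hq
  have hpos : 0 < 2 * Real.exp 1 * (q : ℝ) / (1 + (δ : ℝ)) := by positivity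
  have h1 : ∏ i ∈ Finset.Icc 1 δ, (1 - (q : ℝ) / (2 * (2 * (q : ℝ) + (i : ℝ)))) ≤
      ∏ i ∈ Finset.Icc 1 δ, Real.exp (-((q : ℝ) / 2 * (1 / (2 * (q : ℝ) + (i : ℝ))))) := by
    apply Finset.prod_le_prod
    · intro i _
      have : (0 : ℝ) ≤ i := Nat.cast_nonneg i
      rw [sub_nonneg, div_le_one (by positivity)]
      linarith
    · intro i _
      have hi : (2 * (q : ℝ) + (i : ℝ)) ≠ 0 := by positivity
      have e : (q : ℝ) / (2 * (2 * (q : ℝ) + (i : ℝ)))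
          = (q : ℝ) / 2 * (1 / (2 * (q : ℝ) + (i : ℝ))) := by
        field_simp
      rw [e]
      exact Real.one_sub_le_exp_neg _
  refine h1.trans ?_
  rw [← Real.exp_sum, Real.rpow_def_of_pos hpos, Real.exp_le_exp, Finset.sum_neg_distrib,
    ← Finset.mul_sum, Real.log_div (by positivity) (by positivity)]
  have h2 := aux_sum q δ
  have h3 : Real.log (1 + (δ : ℝ)) ≤ Real.log (2 * (q : ℝ) + 1 + δ) :=
    Real.log_le_log (by positivity) (by linarith)
  have h4 : Real.log (2 * (q : ℝ) + 1) ≤ Real.log (2 * Real.exp 1 * (q : ℝ)) := by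
    apply Real.log_le_log (by positivity)
    have := Real.add_one_le_exp (1 : ℝ)
    nlinarith
  have h5 := mul_le_mul_of_nonneg_left (h2.trans' (sub_le_sub h3 h4))
    (by positivity : (0 : ℝ) ≤ (q : ℝ) / 2)
  linarith
end
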